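/- The four functions I₁ = ((1+f')cos g' - g' sin g') e^{f'}/x, I₂ = ((1+f')sin g' + g' cos g') e^{f'}/x, and the corresponding I₃, I₄ from scaling/rotation operators, with I₃ = ((f(1+f') - g g' - x(f'² - g'²))cos g' - (g(1+f') + f g' - 2x f' g')sin g') e^{f'}/x, I₄ = ((f(1+f') - g g' - x(f'² - g'²))sin g' + (g(1+f') + f g' - 2x f' g')cos g') e^{f'}/x, are first integrals of the system x(2+f')f'' - x g' g'' = f' + 1, x(2+f')g'' + x g' f'' = g'. -/

import Mathlib

/-- If `x (A' + A p' - B q') = A` and `x (B' + B p' + A q') = B`, then the real part of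
`(A + B i) e ^ (p + q i) / x` has derivative zero at `x`. -/
theorem hasDerivAt_re_mul_exp_div_eq_zero {A B p q : ℝ → ℝ} {A' B' p' q' x : ℝ} (hx : x ≠ 0)
    (hA : HasDerivAt A A' x) (hB : HasDerivAt B B' x)
    (hp : HasDerivAt p p' x) (hq : HasDerivAt q q' x)
    (h1 : x * (A' + A x * p' - B x * q') = A x) (h2 : x * (B' + B x * p' + A x * q') = B x) :
    HasDerivAt (fun t => (A t * Real.cos (q t) - B t * Real.sin (q t)) * Real.exp (p t) / t)
      0 x := by
  refine ((((hA.mul hq.cos).sub (hB.mul hq.sin)).mul hp.exp).div (hasDerivAt_id x) hx).congr_deriv ?_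
  rw [div_eq_zero_iff]
  left
  simp only [Pi.mul_apply, Pi.sub_apply, id]
  linear_combination Real.exp (p x) * (Real.cos (q x) * h1 - Real.sin (q x) * h2)

/-- If `x (A' + A p' - B q') = A` and `x (B' + B p' + A q') = B`, then the imaginary part of
`(A + B i) e ^ (p + q i) / x` has derivative zero at `x`. -/
theorem hasDerivAt_im_mul_exp_div_eq_zero {A B p q : ℝ → ℝ} {A' B' p' q' x : ℝ} (hx : x ≠ 0)
    (hA : HasDerivAt A A' x) (hB : HasDerivAt B B' x)
    (hp : HasDerivAt p p' x) (hq : HasDerivAt q q' x)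
    (h1 : x * (A' + A x * p' - B x * q') = A x) (h2 : x * (B' + B x * p' + A x * q') = B x) :
    HasDerivAt (fun t => (A t * Real.sin (q t) + B t * Real.cos (q t)) * Real.exp (p t) / t)
      0 x := by
  refine ((((hA.mul hq.sin).add (hB.mul hq.cos)).mul hp.exp).div (hasDerivAt_id x) hx).congr_deriv ?_
  rw [div_eq_zero_iff]
  left
  simp only [Pi.mul_apply, Pi.add_apply, id]
  linear_combination Real.exp (p x) * (Real.sin (q x) * h1 + Real.cos (q x) * h2)


open Real in
/-- Four first integrals of the system `x(2+f')f'' - x g' g'' = f' + 1`,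
`x(2+f')g'' + x g' f'' = g'` on an interval avoiding `x = 0`. -/
theorem first_integrals_four_noether_like
    (I : Set ℝ) (hI : IsOpen I) (h0 : (0:ℝ) ∉ I)
    (f g f' g' f'' g'' : ℝ → ℝ)
    (hf : ∀ x, HasDerivAt f (f' x) x) (hf' : ∀ x, HasDerivAt f' (f'' x) x)
    (hg : ∀ x, HasDerivAt g (g' x) x) (hg' : ∀ x, HasDerivAt g' (g'' x) x)
    (ode1 : ∀ x ∈ I, x * (2 + f' x) * f'' x - x * g' x * g'' x = f' x + 1)
    (ode2 : ∀ x ∈ I, x * (2 + f' x) * g'' x + x * g' x * f'' x = g' x) :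
    (∀ x ∈ I, deriv (fun t => ((1 + f' t) * cos (g' t) - g' t * sin (g' t))
        * exp (f' t) / t) x = 0) ∧
    (∀ x ∈ I, deriv (fun t => ((1 + f' t) * sin (g' t) + g' t * cos (g' t))
        * exp (f' t) / t) x = 0) ∧
    (∀ x ∈ I, deriv (fun t =>
        ((f t * (1 + f' t) - g t * g' t - t * (f' t ^ 2 - g' t ^ 2)) * cos (g' t)
          - (g t * (1 + f' t) + f t * g' t - 2 * t * f' t * g' t) * sin (g' t))
        * exp (f' t) / t) x = 0) ∧
    (∀ x ∈ I, deriv (fun t =>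
        ((f t * (1 + f' t) - g t * g' t - t * (f' t ^ 2 - g' t ^ 2)) * sin (g' t)
          + (g t * (1 + f' t) + f t * g' t - 2 * t * f' t * g' t) * cos (g' t))
        * exp (f' t) / t) x = 0) := by
  have hne : ∀ x ∈ I, x ≠ 0 := fun x hx hx0 => h0 (hx0 ▸ hx)
  have hA : ∀ x, HasDerivAt (fun t => 1 + f' t) (f'' x) x := fun x => (hf' x).const_add 1
  have hC : ∀ x, HasDerivAt (fun t => f t * (1 + f' t) - g t * g' t - t * (f' t ^ 2 - g' t ^ 2))
      (f' x * (1 + f' x) + f x * f'' x - (g' x * g' x + g x * g'' x)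
        - (f' x ^ 2 - g' x ^ 2 + x * (2 * f' x * f'' x - 2 * g' x * g'' x))) x := fun x =>
    ((((hf x).mul (hA x)).sub ((hg x).mul (hg' x))).sub
      ((hasDerivAt_id x).mul (((hf' x).pow 2).sub ((hg' x).pow 2)))).congr_deriv (by simp)
  have hD : ∀ x, HasDerivAt (fun t => g t * (1 + f' t) + f t * g' t - 2 * t * f' t * g' t)
      (g' x * (1 + f' x) + g x * f'' x + (f' x * g' x + f x * g'' x)
        - ((2 * f' x + 2 * x * f'' x) * g' x + 2 * x * f' x * g'' x)) x := fun x =>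
    ((((hg x).mul (hA x)).add ((hf x).mul (hg' x))).sub
      ((((hasDerivAt_id x).const_mul 2).mul (hf' x)).mul (hg' x))).congr_deriv (by simp)
  have h1 : ∀ x ∈ I, x * (f'' x + (1 + f' x) * f'' x - g' x * g'' x) = 1 + f' x :=
    fun x hx => by linear_combination ode1 x hx
  have h2 : ∀ x ∈ I, x * (g'' x + g' x * f'' x + (1 + f' x) * g'' x) = g' x :=
    fun x hx => by linear_combination ode2 x hx
  refine ⟨fun x hx => ?_, fun x hx => ?_, fun x hx => ?_, fun x hx => ?_⟩
  · exact (hasDerivAt_re_mul_exp_div_eq_zero (hne x hx) (hA x) (hg' x) (hf' x) (hg' x)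
      (h1 x hx) (h2 x hx)).deriv
  · exact (hasDerivAt_im_mul_exp_div_eq_zero (hne x hx) (hA x) (hg' x) (hf' x) (hg' x)
      (h1 x hx) (h2 x hx)).deriv
  · refine (hasDerivAt_re_mul_exp_div_eq_zero (hne x hx) (hC x) (hD x) (hf' x) (hg' x)
      ?_ ?_).deriv
    · linear_combination (f x - x * f' x) * ode1 x hx - (g x - x * g' x) * ode2 x hx
    · linear_combination (g x - x * g' x) * ode1 x hx + (f x - x * f' x) * ode2 x hx
  · refine (hasDerivAt_im_mul_exp_div_eq_zero (hne x hx) (hC x) (hD x) (hf' x) (hg' x)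
      ?_ ?_).deriv
    · linear_combination (f x - x * f' x) * ode1 x hx - (g x - x * g' x) * ode2 x hx
    · linear_combination (g x - x * g' x) * ode1 x hx + (f x - x * f' x) * ode2 x hx
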